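/- arXiv:1702.08877 — 4 statements merged into one kernel-verified Lean document; each statement's English description precedes it below -/
import Mathlib

section
/- Let A be a unital associative algebra over a commutative unital ring R, let e be a nontrivial idempotent in A and f = 1 − e, and suppose A satisfies property (Q). Then the centre Z(A) equals the set of all elements a + b with a ∈ eAe and b ∈ fAf such that am = mb for every m ∈ eAf and ta = bt for every t ∈ fAe. -/
open Finset

/-- Iterated commutator: `pCom x k = p_{k+1}(x 0, ..., x k)`, i.e.
`pCom x 0 = x 0` and `pCom x (k+1) = [pCom x k, x (k+1)]`. -/
def pCom {A : Type*} [Ring A] (x : ℕ → A) : ℕ → A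
  | 0 => x 0
  | k + 1 => pCom x k * x (k + 1) - x (k + 1) * pCom x k

/-- `φ` is a Lie `n`-derivation. -/
def IsLieNDeriv {R : Type*} {A : Type*} [CommRing R] [Ring A] [Algebra R A]
    (n : ℕ) (φ : A →ₗ[R] A) : Prop :=
  ∀ x : ℕ → A,
    φ (pCom x (n - 1)) =
      ∑ i ∈ Finset.range n, pCom (Function.update x i (φ (x i))) (n - 1)

/-- `d` is a derivation. -/
def IsDeriv {R : Type*} {A : Type*} [CommRing R] [Ring A] [Algebra R A]
    (d : A →ₗ[R] A) : Prop :=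
  ∀ x y : A, d (x * y) = d x * y + x * d y

/-- `δ` is a Jordan derivation. -/
def IsJordanDeriv {R : Type*} {A : Type*} [CommRing R] [Ring A] [Algebra R A]
    (δ : A →ₗ[R] A) : Prop :=
  ∀ x y : A, δ (x * y + y * x) = δ x * y + y * δ x + x * δ y + δ y * x

/-- `δ` is an antiderivation. -/
def IsAntiDeriv {R : Type*} {A : Type*} [CommRing R] [Ring A] [Algebra R A]
    (δ : A →ₗ[R] A) : Prop :=
  ∀ x y : A, δ (x * y) = δ y * x + y * δ x

/-- `δ` is a singular Jordan derivation relative to the idempotent `e`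
(with `f = 1 - e`): it is a Jordan derivation killing `eAe` and `fAf`,
mapping `eAf` into `fAe` and `fAe` into `eAf`. -/
def IsSingularJordanDeriv {R : Type*} {A : Type*} [CommRing R] [Ring A] [Algebra R A]
    (e : A) (δ : A →ₗ[R] A) : Prop :=
  IsJordanDeriv δ ∧
  (∀ a : A, δ (e * a * e) = 0) ∧
  (∀ b : A, δ ((1 - e) * b * (1 - e)) = 0) ∧
  (∀ m : A, δ (e * m * (1 - e)) = (1 - e) * δ (e * m * (1 - e)) * e) ∧
  (∀ t : A, δ ((1 - e) * t * e) = e * δ ((1 - e) * t * e) * (1 - e))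

/-- `z` is a central element. -/
def IsCent {A : Type*} [Ring A] (z : A) : Prop := ∀ y : A, z * y = y * z

/-- The centre of `A` as a set. -/
def centerSet (A : Type*) [Ring A] : Set A := {z : A | ∀ y : A, z * y = y * z}

/-- `γ` vanishes on all `(n-1)`-th commutators. -/
def VanishesOnNCommutators {R : Type*} {A : Type*} [CommRing R] [Ring A] [Algebra R A]
    (n : ℕ) (γ : A →ₗ[R] A) : Prop :=
  ∀ x : ℕ → A, γ (pCom x (n - 1)) = 0

/-- A Lie `n`-derivation is standard if it is the sum of a derivation and a
central-valued map vanishing on all `(n-1)`-th commutators. -/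
def IsStandardLieNDeriv {R : Type*} {A : Type*} [CommRing R] [Ring A] [Algebra R A]
    (n : ℕ) (φ : A →ₗ[R] A) : Prop :=
  ∃ d γ : A →ₗ[R] A,
    IsDeriv d ∧ (∀ x : A, IsCent (γ x)) ∧ VanishesOnNCommutators n γ ∧ φ = d + γ

/-- Property (Q) for the idempotent `e` (with `f = 1 - e`):
`exe·eAf = 0 = fAe·exe` implies `exe = 0`, and
`eAf·fxf = 0 = fxf·fAe` implies `fxf = 0`. -/
def PropQ {A : Type*} [Ring A] (e : A) : Prop :=
  (∀ x : A,
    ((∀ y : A, (e * x * e) * (e * y * (1 - e)) = 0) ∧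
     (∀ y : A, ((1 - e) * y * e) * (e * x * e) = 0)) → e * x * e = 0) ∧
  (∀ x : A,
    ((∀ y : A, (e * y * (1 - e)) * ((1 - e) * x * (1 - e)) = 0) ∧
     (∀ y : A, ((1 - e) * x * (1 - e)) * ((1 - e) * y * e) = 0)) →
        (1 - e) * x * (1 - e) = 0)

/-- `A` is `k`-torsion free. -/
def TorsionFreeAt (A : Type*) [Ring A] (k : ℕ) : Prop :=
  ∀ x : A, k • x = 0 → x = 0

/-- The centre of the corner algebra `gAg` (for an idempotent `g`). -/
def cornerCenter {A : Type*} [Ring A] (g : A) : Set A :=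
  {z : A | z = g * z * g ∧ ∀ a : A, z * (g * a * g) = (g * a * g) * z}

/-- The corner algebra `gAg` has no nonzero central ideal: every
ideal of `gAg` consisting of elements central in `gAg` is zero. -/
def NoNonzeroCentralIdeal (R : Type*) [CommRing R] (A : Type*) [Ring A] [Algebra R A]
    (g : A) : Prop :=
  ∀ I : Set A, (0 : A) ∈ I →
    (∀ x ∈ I, x = g * x * g) →
    (∀ x ∈ I, ∀ y ∈ I, x + y ∈ I) →
    (∀ r : R, ∀ x ∈ I, r • x ∈ I) →
    (∀ x ∈ I, ∀ a : A, (g * a * g) * x ∈ I) →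
    (∀ x ∈ I, ∀ a : A, x * (g * a * g) ∈ I) →
    (∀ x ∈ I, ∀ a : A, x * (g * a * g) = (g * a * g) * x) →
    ∀ x ∈ I, x = 0

/-- The generating set of `S(gAg)`: all idempotents of `gAg` together with all
commutators of elements of `gAg`. -/
def cornerGenSet {A : Type*} [Ring A] (g : A) : Set A :=
  {x : A | x = g * x * g ∧ x * x = x} ∪
  {x : A | ∃ a b : A, x = (g * a * g) * (g * b * g) - (g * b * g) * (g * a * g)}

/-- `gAg = S(gAg)`: the corner algebra is generated (as an algebra) by its
idempotents and commutators. -/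
def CornerGenerated (R : Type*) [CommRing R] {A : Type*} [Ring A] [Algebra R A]
    (g : A) : Prop :=
  ∀ x : A, g * x * g ∈ NonUnitalAlgebra.adjoin R (cornerGenSet g)

/-- Condition (*) for the corner algebra `gAg`: if `[x, gAg] ⊆ Z(gAg)` then
`x ∈ Z(gAg)`. -/
def CornerCondStar {A : Type*} [Ring A] (g : A) : Prop :=
  ∀ x : A, x = g * x * g →
    (∀ a : A, x * (g * a * g) - (g * a * g) * x ∈ cornerCenter g) →
    x ∈ cornerCenter g

/-- If `a` lies in the corner `eAe`, intertwines `eAf` and `fAe` with some `b`, and elements of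
`eAe` annihilating both off-diagonal corners vanish, then `a` is central in `eAe`. -/
theorem corner_commute {A : Type*} [Ring A] {e f a b : A} (he : e * e = e)
    (hea : e * a = a) (hae : a * e = a)
    (hQ : ∀ x : A, (∀ y : A, (e * x * e) * (e * y * f) = 0) →
      (∀ y : A, (f * y * e) * (e * x * e) = 0) → e * x * e = 0)
    (hm : ∀ m : A, a * (e * m * f) = (e * m * f) * b)
    (ht : ∀ t : A, (f * t * e) * a = b * (f * t * e)) (c : A) :
    a * (e * c * e) = (e * c * e) * a := by
  have hee (z : A) : e * (e * z) = e * z := by rw [← mul_assoc, he]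
  have hx : e * (a * (e * c * e) - (e * c * e) * a) * e =
      a * (e * c * e) - (e * c * e) * a := by
    calc _ = (e * a) * (e * c * (e * e)) - (e * e) * c * e * (a * e) := by noncomm_ring
      _ = _ := by rw [hea, hae, he]
  rw [← sub_eq_zero, ← hx]
  refine hQ _ (fun y => ?_) (fun y => ?_) <;> rw [hx]
  · calc _ = a * (e * (c * (e * e) * y) * f) - e * c * e * (a * (e * y * f)) := by noncomm_ring
      _ = 0 := by rw [hm, hm]; simp only [mul_assoc, hee, sub_self]
  · calc _ = (f * y * e) * a * (e * c * e) - (f * (y * (e * e) * c) * e) * a := by noncomm_ring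
      _ = 0 := by rw [ht, ht]; simp only [mul_assoc, hee, sub_self]

theorem stmt_0 (R : Type*) [CommRing R] (A : Type*) [Ring A] [Algebra R A]
    (e : A) (he : e * e = e) (he0 : e ≠ 0) (he1 : e ≠ 1) (hQ : PropQ e) :
    centerSet A =
      {x : A | ∃ a b : A, a = e * a * e ∧ b = (1 - e) * b * (1 - e) ∧
        (∀ m : A, a * (e * m * (1 - e)) = (e * m * (1 - e)) * b) ∧
        (∀ t : A, ((1 - e) * t * e) * a = b * ((1 - e) * t * e)) ∧
        x = a + b} := by
  have hef : e * (1 - e) = 0 := by rw [mul_sub, he, mul_one, sub_self]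
  have hfe : (1 - e) * e = 0 := by rw [sub_mul, he, one_mul, sub_self]
  have hff : (1 - e) * (1 - e) = 1 - e := by rw [mul_sub, hfe, mul_one, sub_zero]
  ext x
  constructor
  · intro hx
    have hxe : e * x * e = x * e := by rw [← hx e, mul_assoc, he]
    have hxf : (1 - e) * x * (1 - e) = x * (1 - e) := by rw [← hx (1 - e), mul_assoc, hff]
    refine ⟨x * e, x * (1 - e), ?_, ?_, fun m => ?_, fun t => ?_, by noncomm_ring⟩
    · rw [← mul_assoc, hxe, mul_assoc, he]
    · rw [← mul_assoc, hxf, mul_assoc, hff]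
    · calc _ = x * ((e * e) * m * (1 - e)) := by noncomm_ring
        _ = (e * m * ((1 - e) * (1 - e))) * x := by rw [he, hff, hx]
        _ = (e * m * (1 - e)) * ((1 - e) * x) := by simp only [mul_assoc]
        _ = _ := by rw [← hx (1 - e)]
    · calc _ = ((1 - e) * t * e) * (e * x) := by rw [hx e]
        _ = ((1 - e) * t * (e * e)) * x := by simp only [mul_assoc]
        _ = x * (((1 - e) * (1 - e)) * t * e) := by rw [he, hff, hx]
        _ = _ := by simp only [mul_assoc]
  · rintro ⟨a, b, ha, hb, hm, ht, rfl⟩ y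
    have hea : e * a = a := by rw [ha, ← mul_assoc, ← mul_assoc, he]
    have hae : a * e = a := by rw [ha, mul_assoc, he]
    have hfb : (1 - e) * b = b := by rw [hb, ← mul_assoc, ← mul_assoc, hff]
    have hbf : b * (1 - e) = b := by rw [hb, mul_assoc, hff]
    have hca := corner_commute he hea hae (fun x h₁ h₂ => hQ.1 x ⟨h₁, h₂⟩) hm ht y
    have hcb := corner_commute hff hfb hbf (fun x h₁ h₂ => hQ.2 x ⟨h₂, h₁⟩)
      (fun t => (ht t).symm) (fun m => (hm m).symm) y
    have haf : a * (1 - e) = 0 := by rw [← hae, mul_assoc, hef, mul_zero]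
    have hfa : (1 - e) * a = 0 := by rw [← hea, ← mul_assoc, hfe, zero_mul]
    have hbe : b * e = 0 := by rw [← hbf, mul_assoc, hfe, mul_zero]
    have heb : e * b = 0 := by rw [← hfb, ← mul_assoc, hef, zero_mul]
    calc (a + b) * y
        = a * (e * y * e) + a * (e * y * (1 - e)) + b * ((1 - e) * y * e)
          + b * ((1 - e) * y * (1 - e)) + a * (1 - e) * y + b * e * y := by noncomm_ring
      _ = (e * y * e) * a + (e * y * (1 - e)) * b + ((1 - e) * y * e) * a
          + ((1 - e) * y * (1 - e)) * b + y * ((1 - e) * a) + y * (e * b) := by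
        rw [hca, hcb, hm, ht, haf, hbe, hfa, heb, zero_mul, mul_zero]
      _ = y * (a + b) := by noncomm_ring
end

section
/- Let A be a unital associative algebra over a commutative unital ring R, let e be a nontrivial idempotent in A and f = 1 − e, and suppose A satisfies property (Q). If x ∈ A satisfies [x,m] = 0 for every m ∈ eAf and [x,t] = 0 for every t ∈ fAe, then exe + fxf ∈ Z(A). -/
open Finset

/-- If `z` commutes with `m` and with `p * m`, then `[z, p] * m = 0`. -/
theorem commutator_mul_eq_zero {A : Type*} [Ring A] {z p m : A}
    (hm : Commute z m) (hpm : Commute z (p * m)) : (z * p - p * z) * m = 0 := by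
  rw [sub_mul, mul_assoc, mul_assoc, hpm.eq, hm.eq, mul_assoc, sub_self]

/-- If `z` commutes with `m` and with `m * p`, then `m * [z, p] = 0`. -/
theorem mul_commutator_eq_zero {A : Type*} [Ring A] {z p m : A}
    (hm : Commute z m) (hmp : Commute z (m * p)) : m * (z * p - p * z) = 0 := by
  rw [mul_sub, ← mul_assoc, ← mul_assoc, ← hm.eq, mul_assoc, hmp.eq, sub_self]

/-- The commutator of `z` with `g * a * g` lies in the corner of `g`
when `z` commutes with the idempotent `g`. -/
theorem corner_commutator {A : Type*} [Ring A] {g z : A} (hg : g * g = g)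
    (hz : Commute z g) (a : A) :
    g * (z * (g * a * g) - (g * a * g) * z) * g = z * (g * a * g) - (g * a * g) * z := by
  have h₁ : g * (z * (g * a * g)) = z * (g * a * g) := by
    rw [← mul_assoc, ← hz.eq, mul_assoc, ← mul_assoc g, ← mul_assoc g, hg]
  have h₂ : g * a * g * z * g = g * a * g * z := by
    rw [mul_assoc _ z, hz.eq, ← mul_assoc, mul_assoc _ g g, hg]
  have h₃ : z * (g * a * g) * g = z * (g * a * g) := by
    simp only [mul_assoc, hg]
  have h₄ : g * (g * a * g * z) = g * a * g * z := by
    simp only [← mul_assoc, hg]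
  rw [mul_sub, sub_mul, h₁, h₃, h₄, h₂]

/-- Under property (Q), an element that commutes with `e` and with both off-diagonal Peirce
components is central. -/
theorem PropQ.mem_centerSet {A : Type*} [Ring A] {e z : A} (hQ : PropQ e) (he : e * e = e)
    (hz : Commute z e) (hm : ∀ m : A, Commute z (e * m * (1 - e)))
    (ht : ∀ t : A, Commute z ((1 - e) * t * e)) : z ∈ centerSet A := by
  have hf : (1 - e) * (1 - e) = 1 - e := IsIdempotentElem.one_sub he
  have hzf : Commute z (1 - e) := (Commute.one_right z).sub_right hz
  have hee : ∀ a : A, Commute z (e * a * e) := by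
    intro a
    have h := hQ.1 (z * (e * a * e) - (e * a * e) * z)
    rw [corner_commutator he hz] at h
    refine sub_eq_zero.mp (h ⟨fun y => ?_, fun y => ?_⟩)
    · refine commutator_mul_eq_zero (hm y) ?_
      simpa only [mul_assoc] using hm (a * e * e * y)
    · refine mul_commutator_eq_zero (ht y) ?_
      simpa only [mul_assoc] using ht (y * e * e * a)
  have hff : ∀ a : A, Commute z ((1 - e) * a * (1 - e)) := by
    intro a
    have h := hQ.2 (z * ((1 - e) * a * (1 - e)) - ((1 - e) * a * (1 - e)) * z)
    rw [corner_commutator hf hzf] at h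
    refine sub_eq_zero.mp (h ⟨fun y => ?_, fun y => ?_⟩)
    · refine mul_commutator_eq_zero (hm y) ?_
      simpa only [mul_assoc] using hm (y * (1 - e) * (1 - e) * a)
    · refine commutator_mul_eq_zero (ht y) ?_
      simpa only [mul_assoc] using ht (a * (1 - e) * (1 - e) * y)
  intro y
  have hy : y = e * y * e + e * y * (1 - e) + ((1 - e) * y * e + (1 - e) * y * (1 - e)) := by
    noncomm_ring
  rw [hy]
  exact (((hee y).add_right (hm y)).add_right ((ht y).add_right (hff y))).eq

/-- If `e` and `f` are idempotents with `f * e = 0` and `x` commutes with `e * m * f`, then so does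
the diagonal part `e * x * e + f * x * f`. -/
theorem commute_diagonal_of_commute {A : Type*} [Ring A] {e f x m : A} (he : e * e = e)
    (hf : f * f = f) (hfe : f * e = 0) (h : Commute x (e * m * f)) :
    Commute (e * x * e + f * x * f) (e * m * f) := by
  have h₁ : (e * x * e + f * x * f) * (e * m * f) = e * (x * (e * m * f)) * f := by
    have h₂ : f * x * f * (e * m * f) = 0 := by
      rw [mul_assoc e, ← mul_assoc, mul_assoc _ f e, hfe, mul_zero, zero_mul]
    have h₃ : e * x * e * (e * m * f) = e * x * (e * m * f) := by
      rw [mul_assoc _ e, ← mul_assoc e, ← mul_assoc e, he]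
    rw [add_mul, h₂, h₃, add_zero]
    simp only [mul_assoc, hf]
  have h₄ : (e * m * f) * (e * x * e + f * x * f) = e * (e * m * f * x) * f := by
    have h₅ : e * m * f * (e * x * e) = 0 := by
      rw [mul_assoc e x, ← mul_assoc, mul_assoc _ f e, hfe, mul_zero, zero_mul]
    have h₆ : e * m * f * (f * x * f) = e * m * f * x * f := by
      rw [mul_assoc f x, ← mul_assoc, mul_assoc _ f f, hf, ← mul_assoc]
    rw [mul_add, h₅, h₆, zero_add]
    simp only [← mul_assoc, he]
  rw [Commute, SemiconjBy, h₁, h₄, h.eq]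

theorem stmt_1 (R : Type*) [CommRing R] (A : Type*) [Ring A] [Algebra R A]
    (e : A) (he : e * e = e) (he0 : e ≠ 0) (he1 : e ≠ 1) (hQ : PropQ e)
    (x : A)
    (hm : ∀ m : A, x * (e * m * (1 - e)) - (e * m * (1 - e)) * x = 0)
    (ht : ∀ t : A, x * ((1 - e) * t * e) - ((1 - e) * t * e) * x = 0) :
    e * x * e + (1 - e) * x * (1 - e) ∈ centerSet A := by
  have hf : (1 - e) * (1 - e) = 1 - e := IsIdempotentElem.one_sub he
  have hef : e * (1 - e) = 0 := by rw [mul_sub, he, mul_one, sub_self]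
  have hfe : (1 - e) * e = 0 := by rw [sub_mul, he, one_mul, sub_self]
  refine hQ.mem_centerSet he ?_ (fun m => ?_) (fun t => ?_)
  · have h₁ : (e * x * e + (1 - e) * x * (1 - e)) * e = e * x * e := by
      rw [add_mul, mul_assoc _ (1 - e) e, hfe, mul_zero, add_zero, mul_assoc _ e e, he]
    have h₂ : e * (e * x * e + (1 - e) * x * (1 - e)) = e * x * e := by
      simp only [mul_add, ← mul_assoc, he, hef, zero_mul, add_zero]
    exact h₁.trans h₂.symm
  · exact commute_diagonal_of_commute he hf hfe (sub_eq_zero.mp (hm m))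
  · rw [add_comm]
    exact commute_diagonal_of_commute hf he hef (sub_eq_zero.mp (ht t))
end

section
/- Let A be a unital associative algebra over a commutative unital ring R, let e be a nontrivial idempotent in A and f = 1 − e, let n ≥ 2, and let φ be a Lie n-derivation on A. Set x₀ = eφ(e)f − fφ(e)e and define d : A → A by d(x) = [x, x₀]. Then d is a derivation on A, φ − d is a Lie n-derivation on A, and e(φ − d)(e)f = 0 and f(φ − d)(e)e = 0. -/
open Finset

theorem pCom_update_of_lt {A : Type*} [Ring A] (x : ℕ → A) (a : A) {i k : ℕ} (h : k < i) :
    pCom (Function.update x i a) k = pCom x k := by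
  induction k with
  | zero => simp [pCom, h.ne]
  | succ k ih => simp [pCom, ih (by omega), h.ne]

theorem pCom_update_sub {A : Type*} [Ring A] (x : ℕ → A) (a b : A) {i k : ℕ} (h : i ≤ k) :
    pCom (Function.update x i (a - b)) k =
      pCom (Function.update x i a) k - pCom (Function.update x i b) k := by
  induction k with
  | zero =>
    obtain rfl : i = 0 := by omega
    simp [pCom]
  | succ k ih =>
    rcases h.eq_or_lt with rfl | h
    · simp only [pCom, pCom_update_of_lt x _ k.lt_succ_self, Function.update_self]
      noncomm_ring
    · simp only [pCom, ih (Nat.lt_succ_iff.mp h), Function.update_of_ne h.ne']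
      noncomm_ring

theorem IsDeriv.isLieNDeriv {R A : Type*} [CommRing R] [Ring A] [Algebra R A]
    {d : A →ₗ[R] A} (hd : IsDeriv d) {n : ℕ} (hn : 1 ≤ n) : IsLieNDeriv n d := by
  intro x
  obtain ⟨k, rfl⟩ : ∃ k, n = k + 1 := ⟨n - 1, by omega⟩
  simp only [Nat.add_sub_cancel]
  clear hn
  induction k with
  | zero => simp [pCom]
  | succ k ih =>
    have hsum : ∑ i ∈ range (k + 1), pCom (Function.update x i (d (x i))) (k + 1) =
        d (pCom x k) * x (k + 1) - x (k + 1) * d (pCom x k) := by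
      rw [ih, sum_mul, mul_sum, ← sum_sub_distrib]
      refine sum_congr rfl fun i hi => ?_
      simp only [pCom, Function.update_of_ne (mem_range.mp hi).ne']
    rw [sum_range_succ, hsum]
    simp only [pCom, map_sub, hd _ _, pCom_update_of_lt x _ k.lt_succ_self, Function.update_self]
    abel

theorem IsLieNDeriv.sub {R A : Type*} [CommRing R] [Ring A] [Algebra R A] {n : ℕ}
    {φ ψ : A →ₗ[R] A} (hφ : IsLieNDeriv n φ) (hψ : IsLieNDeriv n ψ) :
    IsLieNDeriv n (φ - ψ) := by
  intro x
  rw [LinearMap.sub_apply, hφ x, hψ x, ← sum_sub_distrib]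
  refine sum_congr rfl fun i hi => ?_
  rw [LinearMap.sub_apply, pCom_update_sub x _ _ (Nat.le_sub_one_of_lt (mem_range.mp hi))]

theorem stmt_2 (R : Type*) [CommRing R] (A : Type*) [Ring A] [Algebra R A]
    (e : A) (he : e * e = e) (he0 : e ≠ 0) (he1 : e ≠ 1)
    (n : ℕ) (hn : 2 ≤ n) (φ : A →ₗ[R] A) (hφ : IsLieNDeriv n φ)
    (d : A →ₗ[R] A)
    (hd : ∀ x : A,
      d x = x * (e * φ e * (1 - e) - (1 - e) * φ e * e)
          - (e * φ e * (1 - e) - (1 - e) * φ e * e) * x) :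
    IsDeriv d ∧ IsLieNDeriv n (φ - d) ∧
      e * ((φ - d) e) * (1 - e) = 0 ∧ (1 - e) * ((φ - d) e) * e = 0 := by
  have hder : IsDeriv d := by
    intro x y
    simp only [hd]
    noncomm_ring
  have he' : ∀ y : A, e * (e * y) = e * y := fun y => by rw [← mul_assoc, he]
  refine ⟨hder, hφ.sub (hder.isLieNDeriv (by omega)), ?_, ?_⟩ <;>
  · rw [LinearMap.sub_apply, hd]
    simp only [mul_sub, sub_mul, mul_one, one_mul, mul_assoc, he, he']
    abel
end

section
/- Let A be a unital associative algebra over a commutative unital ring R that is 2-torsion free and (n−1)-torsion free, let e be a nontrivial idempotent in A and f = 1 − e, suppose A satisfies property (Q), let n ≥ 2, and let φ be a Lie n-derivation on A. Then φ = d + δ + γ, where d is a derivation on A, δ is a singular Jordan derivation on A, and γ is an R-linear map from A into Z(A) vanishing on all (n−1)-th commutators of A, if and only if both: (i) fφ(a)f ∈ fZ(A)f for every a ∈ eAe and eφ(b)e ∈ eZ(A)e for every b ∈ fAf; and (ii) eφ(tm)e + fφ(mt)f ∈ Z(A) for every m ∈ eAf and t ∈ fAe. -/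
open Finset

section Recursion

variable {R A : Type*} [CommRing R] [Ring A] [Algebra R A]

/-- The Leibniz expansion of `φ` on an iterated commutator, defined recursively. -/
def pLeib (φ : A →ₗ[R] A) (x : ℕ → A) : ℕ → A
  | 0 => φ (x 0)
  | k + 1 => (pLeib φ x k * x (k + 1) - x (k + 1) * pLeib φ x k) +
      (pCom x k * φ (x (k + 1)) - φ (x (k + 1)) * pCom x k)

lemma pCom_congr {x y : ℕ → A} {k : ℕ} (h : ∀ i ≤ k, x i = y i) : pCom x k = pCom y k := by
  induction k with
  | zero => exact h 0 le_rfl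
  | succ k ih => simp only [pCom, ih fun i hi => h i (by omega), h (k + 1) le_rfl]

lemma sum_pCom_update (φ : A →ₗ[R] A) (x : ℕ → A) (k : ℕ) :
    ∑ i ∈ Finset.range (k + 1), pCom (Function.update x i (φ (x i))) k = pLeib φ x k := by
  induction k with
  | zero => simp [pCom, pLeib]
  | succ k ih =>
    rw [Finset.sum_range_succ, pLeib, ← ih, Finset.sum_mul, Finset.mul_sum,
      ← Finset.sum_sub_distrib]
    congr 1
    · refine Finset.sum_congr rfl fun i hi => ?_
      have : k + 1 ≠ i := by have := Finset.mem_range.1 hi; omega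
      simp [pCom, Function.update_of_ne this]
    · have : pCom (Function.update x (k + 1) (φ (x (k + 1)))) k = pCom x k :=
        pCom_congr fun i hi => Function.update_of_ne (by omega) _ _
      simp [pCom, this]

lemma isLieNDeriv_iff {k : ℕ} (φ : A →ₗ[R] A) :
    IsLieNDeriv (k + 1) φ ↔ ∀ x : ℕ → A, φ (pCom x k) = pLeib φ x k := by
  simp only [IsLieNDeriv, Nat.add_sub_cancel, sum_pCom_update]

lemma pLeib_add (φ ψ : A →ₗ[R] A) (x : ℕ → A) (k : ℕ) :
    pLeib (φ + ψ) x k = pLeib φ x k + pLeib ψ x k := by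
  induction k with
  | zero => simp [pLeib]
  | succ k ih => simp only [pLeib, ih, LinearMap.add_apply]; noncomm_ring

lemma pLeib_of_isCent {γ : A →ₗ[R] A} (h : ∀ x, IsCent (γ x)) (x : ℕ → A) (k : ℕ) :
    pLeib γ x (k + 1) = 0 := by
  induction k with
  | zero => simp [pLeib, pCom, h _ _]
  | succ k ih => rw [pLeib, ih]; simp [h _ _]

lemma IsDeriv.map_pCom {d : A →ₗ[R] A} (h : IsDeriv d) (x : ℕ → A) (k : ℕ) :
    d (pCom x k) = pLeib d x k := by
  induction k with
  | zero => rfl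
  | succ k ih => simp only [pLeib, pCom, map_sub, h _ _, ih]; noncomm_ring

lemma IsJordanDeriv.map_commutator_commutator {δ : A →ₗ[R] A} (h : IsJordanDeriv δ)
    (x y z : A) :
    δ ((x * y - y * x) * z - z * (x * y - y * x)) =
      ((δ x * y - y * δ x + (x * δ y - δ y * x)) * z
        - z * (δ x * y - y * δ x + (x * δ y - δ y * x)))
      + ((x * y - y * x) * δ z - δ z * (x * y - y * x)) := by
  have key : (x * y - y * x) * z - z * (x * y - y * x) =
      (x * (y * z + z * y) + (y * z + z * y) * x) -
      (y * (x * z + z * x) + (x * z + z * x) * y) := by noncomm_ring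
  rw [key, map_sub, h x (y * z + z * y), h y (x * z + z * x), h y z, h x z]
  noncomm_ring

lemma IsJordanDeriv.map_pCom {δ : A →ₗ[R] A} (h : IsJordanDeriv δ) (x : ℕ → A) (j : ℕ) :
    δ (pCom x (2 * j)) = pLeib δ x (2 * j) := by
  induction j with
  | zero => rfl
  | succ j ih =>
    change δ (pCom x (2 * j + 1 + 1)) = pLeib δ x (2 * j + 1 + 1)
    simp only [pCom, pLeib, h.map_commutator_commutator, ih]

end Recursion

section Peirce

variable {R A : Type*} [CommRing R] [Ring A] [Algebra R A]

/-- `e` and `f` are complementary orthogonal idempotents. -/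
structure Peirce (e f : A) : Prop where
  ee : e * e = e
  ff : f * f = f
  ef : e * f = 0
  fe : f * e = 0
  add : e + f = 1

lemma Peirce.symm {e f : A} (P : Peirce e f) : Peirce f e :=
  ⟨P.ff, P.ee, P.fe, P.ef, by rw [add_comm, P.add]⟩

lemma Peirce.of_idempotent {e : A} (he : e * e = e) : Peirce e (1 - e) :=
  ⟨he, by simp [mul_sub, sub_mul, he], by simp [mul_sub, he], by simp [sub_mul, he], by abel⟩

/-- `x` lies in the Peirce corner `iAj`. -/
def InCorner (i j x : A) : Prop := i * x = x ∧ x * j = x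

lemma InCorner.mk' {i j : A} (hi : i * i = i) (hj : j * j = j) (x : A) :
    InCorner i j (i * x * j) := by
  constructor
  · rw [← mul_assoc, ← mul_assoc, hi]
  · rw [mul_assoc, hj]

lemma InCorner.sandwich {i j x : A} (h : InCorner i j x) : i * x * j = x := by
  rw [h.1, h.2]

lemma InCorner.mul {i j k l x y : A} (hx : InCorner i j x) (hy : InCorner k l y) :
    InCorner i l (x * y) := by
  constructor
  · rw [← mul_assoc, hx.1]
  · rw [mul_assoc, hy.2]

lemma InCorner.add {i j x y : A} (hx : InCorner i j x) (hy : InCorner i j y) :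
    InCorner i j (x + y) :=
  ⟨by rw [mul_add, hx.1, hy.1], by rw [add_mul, hx.2, hy.2]⟩

lemma InCorner.sub {i j x y : A} (hx : InCorner i j x) (hy : InCorner i j y) :
    InCorner i j (x - y) :=
  ⟨by rw [mul_sub, hx.1, hy.1], by rw [sub_mul, hx.2, hy.2]⟩

lemma InCorner.mul_eq_zero {i j k l x y : A} (hx : InCorner i j x) (hy : InCorner k l y)
    (h : j * k = 0) : x * y = 0 := by
  rw [← hx.2, ← hy.1, mul_assoc, ← mul_assoc j, h, zero_mul, mul_zero]

/-- Rewriting rules for multiplying an element of a corner by the idempotents. -/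
lemma InCorner.rules {i j i' j' x : A} (h : InCorner i j x) (hi : i' * i = 0) (hj : j * j' = 0) :
    i * x = x ∧ x * j = x ∧ i' * x = 0 ∧ x * j' = 0 ∧
    (∀ z, i * (x * z) = x * z) ∧ (∀ z, x * (j * z) = x * z) ∧
    (∀ z, i' * (x * z) = 0) ∧ (∀ z, x * (j' * z) = 0) := by
  have h3 : i' * x = 0 := by rw [← h.1, ← mul_assoc, hi, zero_mul]
  have h4 : x * j' = 0 := by rw [← h.2, mul_assoc, hj, mul_zero]
  refine ⟨h.1, h.2, h3, h4, fun z => ?_, fun z => ?_, fun z => ?_, fun z => ?_⟩ <;>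
    rw [← mul_assoc]
  · rw [h.1]
  · rw [h.2]
  · rw [h3, zero_mul]
  · rw [h4, zero_mul]

lemma Peirce.decomp {e f : A} (P : Peirce e f) (x : A) :
    x = e * x * e + e * x * f + f * x * e + f * x * f := by
  calc x = (e + f) * x * (e + f) := by rw [P.add, one_mul, mul_one]
    _ = _ := by noncomm_ring

/-- Elements of `eAe` are determined by their two-sided action on the off-diagonal corners. -/
def Faithful (e f : A) : Prop :=
  ∀ x, InCorner e e x → (∀ m, InCorner e f m → x * m = 0) →
    (∀ t, InCorner f e t → t * x = 0) → x = 0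

lemma PropQ.faithful {e : A} (P : Peirce e (1 - e)) (h : PropQ e) :
    Faithful e (1 - e) ∧ Faithful (1 - e) e := by
  constructor
  · intro x hx h1 h2
    have := h.1 x ?_
    · rwa [hx.sandwich] at this
    · rw [hx.sandwich]
      exact ⟨fun y => h1 _ (.mk' P.ee P.ff y), fun y => h2 _ (.mk' P.ff P.ee y)⟩
  · intro x hx h1 h2
    have := h.2 x ?_
    · rwa [hx.sandwich] at this
    · rw [hx.sandwich]
      exact ⟨fun y => h2 _ (.mk' P.ee P.ff y), fun y => h1 _ (.mk' P.ff P.ee y)⟩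

/-- The identities between the corners `eAe`, `eAf`, `fAe`, `fAf` satisfied by a Lie
`n`-derivation `φ` for which `φ e` is central. -/
structure PeirceLie (e f : A) (φ : A →ₗ[R] A) : Prop where
  off : ∀ m, InCorner e f m → e * φ m * e = 0 ∧ f * φ m * f = 0
  diag : ∀ a, InCorner e e a → e * φ a * f = 0 ∧ f * φ a * e = 0
  bracket : ∀ x y, InCorner e f (x * y - y * x) →
    e * φ (x * y - y * x) * f = e * (φ x * y - y * φ x + (x * φ y - φ y * x)) * f ∧
    -(f * φ (x * y - y * x) * e) = f * (φ x * y - y * φ x + (x * φ y - φ y * x)) * e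
  bracket_off : ∀ m y, InCorner e f m →
    φ (m * y - y * m) = (e * φ m * f - f * φ m * e) * y - y * (e * φ m * f - f * φ m * e) +
      (m * φ y - φ y * m)

/-- The compatibility of a decomposition `φ = d + δ + γ` with the corners of `e` and `f`. -/
structure PeirceSplit (e f : A) (φ d δ γ : A →ₗ[R] A) : Prop where
  eq : ∀ x, φ x = d x + δ x + γ x
  cent : ∀ x, IsCent (γ x)
  d_diag : ∀ a, InCorner e e a → InCorner e e (d a)
  d_off : ∀ m, InCorner e f m → InCorner e f (d m)
  δ_diag : ∀ a, InCorner e e a → δ a = 0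
  δ_off : ∀ m, InCorner e f m → InCorner f e (δ m)
  γ_off : ∀ m, InCorner e f m → γ m = 0
  γ_comm : ∀ m t, InCorner e f m → InCorner f e t → γ (m * t) = γ (t * m)

section Split

variable {e f : A} {φ d δ γ : A →ₗ[R] A}

lemma PeirceSplit.bracket_eq (H : PeirceSplit e f φ d δ γ) (x y : A) :
    φ x * y - y * φ x + (x * φ y - φ y * x) =
      (d x + δ x) * y - y * (d x + δ x) + (x * (d y + δ y) - (d y + δ y) * x) := by
  simp only [H.eq, add_mul, mul_add, H.cent x y, H.cent y x]
  abel

lemma PeirceSplit.mul_diag_off (P : Peirce e f) (G : PeirceLie e f φ)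
    (H : PeirceSplit e f φ d δ γ) {a m : A} (ha : InCorner e e a) (hm : InCorner e f m) :
    d (a * m) = d a * m + a * d m ∧ δ (a * m) = δ m * a := by
  have ham := ha.mul hm
  have hma : m * a = 0 := hm.mul_eq_zero ha P.fe
  have key := G.bracket a m (by rwa [hma, sub_zero])
  rw [H.bracket_eq, hma, sub_zero, H.eq, H.γ_off _ ham, H.δ_diag a ha] at key
  have r1 := ha.rules P.fe P.ef
  have r2 := hm.rules P.fe P.fe
  have r3 := (H.d_diag a ha).rules P.fe P.ef
  have r4 := (H.d_off m hm).rules P.fe P.fe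
  have r5 := (H.δ_off m hm).rules P.ef P.ef
  have r6 := (H.d_off _ ham).rules P.fe P.fe
  have r7 := (H.δ_off _ ham).rules P.ef P.ef
  simp only [mul_assoc, mul_add, add_mul, mul_sub, sub_mul, r1, r2, r3, r4, r5, r6, r7,
    add_zero, zero_add, sub_zero, zero_sub, mul_zero, neg_mul, neg_inj] at key
  exact key

lemma PeirceSplit.mul_off_diag (P : Peirce e f) (G : PeirceLie e f φ)
    (H : PeirceSplit e f φ d δ γ) (H' : PeirceSplit f e φ d δ γ) {m b : A}
    (hm : InCorner e f m) (hb : InCorner f f b) :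
    d (m * b) = d m * b + m * d b ∧ δ (m * b) = b * δ m := by
  have hmb := hm.mul hb
  have hbm : b * m = 0 := hb.mul_eq_zero hm P.fe
  have key := G.bracket m b (by rwa [hbm, sub_zero])
  rw [H.bracket_eq, hbm, sub_zero, H.eq, H.γ_off _ hmb, H'.δ_diag b hb] at key
  have r1 := hb.rules P.ef P.fe
  have r2 := hm.rules P.fe P.fe
  have r3 := (H'.d_diag b hb).rules P.ef P.fe
  have r4 := (H.d_off m hm).rules P.fe P.fe
  have r5 := (H.δ_off m hm).rules P.ef P.ef
  have r6 := (H.d_off _ hmb).rules P.fe P.fe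
  have r7 := (H.δ_off _ hmb).rules P.ef P.ef
  simp only [mul_assoc, mul_add, add_mul, mul_sub, sub_mul, r1, r2, r3, r4, r5, r6, r7,
    add_zero, zero_add, sub_zero, zero_sub, mul_zero, neg_mul, neg_zero, neg_inj] at key
  exact key

lemma PeirceSplit.mul_off_off (P : Peirce e f) (G : PeirceLie e f φ)
    (H : PeirceSplit e f φ d δ γ) (H' : PeirceSplit f e φ d δ γ) {m t : A}
    (hm : InCorner e f m) (ht : InCorner f e t) :
    d (m * t) = d m * t + m * d t := by
  have hmt := hm.mul ht
  have htm := ht.mul hm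
  have key := G.bracket_off m t hm
  rw [map_sub, H.eq (m * t), H.eq (t * m), H.γ_comm m t hm ht, H.δ_diag _ hmt,
    H'.δ_diag _ htm, H.eq m, H.eq t, H.γ_off m hm, H'.γ_off t ht] at key
  replace key := congrArg (fun z => e * z * e) key
  have r1 := hm.rules P.fe P.fe
  have r2 := ht.rules P.ef P.ef
  have r3 := (H.d_off m hm).rules P.fe P.fe
  have r4 := (H.δ_off m hm).rules P.ef P.ef
  have r5 := (H'.d_off t ht).rules P.ef P.ef
  have r6 := (H'.δ_off t ht).rules P.fe P.fe
  have r7 := (H.d_diag _ hmt).rules P.fe P.ef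
  have r8 := (H'.d_diag _ htm).rules P.ef P.fe
  simp only [add_zero, add_sub_add_right_eq_sub] at key
  simp only [mul_assoc, mul_add, add_mul, mul_sub, sub_mul, r1, r2, r3, r4, r5, r6, r7, r8,
    add_zero, zero_add, sub_zero, mul_zero] at key
  exact key

lemma PeirceSplit.δ_anticomm (P : Peirce e f) (G : PeirceLie e f φ)
    (H : PeirceSplit e f φ d δ γ) {m m' : A} (hm : InCorner e f m) (hm' : InCorner e f m') :
    δ m * m' + δ m' * m = 0 ∧ m * δ m' + m' * δ m = 0 := by
  have key := G.bracket_off m m' hm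
  rw [hm.mul_eq_zero hm' P.fe, hm'.mul_eq_zero hm P.fe, sub_zero, map_zero, H.eq m, H.eq m',
    H.γ_off m hm, H.γ_off m' hm'] at key
  have r1 := hm.rules P.fe P.fe
  have r2 := hm'.rules P.fe P.fe
  have r3 := (H.d_off m hm).rules P.fe P.fe
  have r4 := (H.δ_off m hm).rules P.ef P.ef
  have r5 := (H.d_off m' hm').rules P.fe P.fe
  have r6 := (H.δ_off m' hm').rules P.ef P.ef
  have key1 := congrArg (fun z => f * z * f) key
  have key2 := congrArg (fun z => e * z * e) key
  simp only [mul_assoc, mul_add, add_mul, mul_sub, sub_mul, r1, r2, r3, r4, r5, r6,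
    add_zero, zero_add, sub_zero, zero_sub, mul_zero, zero_mul, neg_mul] at key1 key2
  constructor
  · rw [← neg_eq_zero, neg_add, key1]
  · rw [key2, neg_neg, add_comm]

lemma PeirceSplit.mul_diag_diag (P : Peirce e f) (G : PeirceLie e f φ) (G' : PeirceLie f e φ)
    (F : Faithful e f)
    (H : PeirceSplit e f φ d δ γ) (H' : PeirceSplit f e φ d δ γ) {a a' : A}
    (ha : InCorner e e a) (ha' : InCorner e e a') :
    d (a * a') = d a * a' + a * d a' := by
  rw [← sub_eq_zero]
  refine F _ ((H.d_diag _ (ha.mul ha')).sub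
    (((H.d_diag a ha).mul ha').add (ha.mul (H.d_diag a' ha')))) (fun m hm => ?_) fun t ht => ?_
  · have h1 := (H.mul_diag_off P G (ha.mul ha') hm).1
    rw [mul_assoc, (H.mul_diag_off P G ha (ha'.mul hm)).1, (H.mul_diag_off P G ha' hm).1] at h1
    rw [sub_mul, ← add_sub_cancel_right (d (a * a') * m) (a * a' * d m), ← h1]
    noncomm_ring
  · have h1 := (H'.mul_off_diag P.symm G' H ht (ha.mul ha')).1
    rw [← mul_assoc, (H'.mul_off_diag P.symm G' H (ht.mul ha) ha').1,
      (H'.mul_off_diag P.symm G' H ht ha).1] at h1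
    rw [mul_sub, ← add_sub_cancel_left (d t * (a * a')) (t * d (a * a')), ← h1]
    noncomm_ring

lemma Peirce.induction_pair (P : Peirce e f) {p : A → A → Prop}
    (hl : ∀ x x' y, p x y → p x' y → p (x + x') y) (hr : ∀ x y y', p x y → p x y' → p x (y + y'))
    (h : ∀ i ∈ ({e, f} : Set A), ∀ j ∈ ({e, f} : Set A), ∀ k ∈ ({e, f} : Set A),
      ∀ l ∈ ({e, f} : Set A), ∀ x y, InCorner i j x → InCorner k l y → p x y) (x y : A) :
    p x y := by
  have hidem : ∀ i ∈ ({e, f} : Set A), i * i = i := by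
    simpa using And.intro P.ee P.ff
  have he : e ∈ ({e, f} : Set A) := by simp
  have hf : f ∈ ({e, f} : Set A) := by simp
  have h' : ∀ x y, ∀ i ∈ ({e, f} : Set A), ∀ j ∈ ({e, f} : Set A), ∀ k ∈ ({e, f} : Set A),
      ∀ l ∈ ({e, f} : Set A), p (i * x * j) (k * y * l) := fun x y i hi j hj k hk l hl =>
    h i hi j hj k hk l hl _ _ (.mk' (hidem i hi) (hidem j hj) x) (.mk' (hidem k hk) (hidem l hl) y)
  have h2 : ∀ x y, ∀ i ∈ ({e, f} : Set A), ∀ j ∈ ({e, f} : Set A), p (i * x * j) y := by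
    intro x y i hi j hj
    rw [P.decomp y]
    exact hr _ _ _ (hr _ _ _ (hr _ _ _ (h' x y i hi j hj e he e he) (h' x y i hi j hj e he f hf))
      (h' x y i hi j hj f hf e he)) (h' x y i hi j hj f hf f hf)
  rw [P.decomp x]
  exact hl _ _ _ (hl _ _ _ (hl _ _ _ (h2 x y e he e he) (h2 x y e he f hf))
    (h2 x y f hf e he)) (h2 x y f hf f hf)

theorem PeirceSplit.isDeriv (P : Peirce e f) (G : PeirceLie e f φ) (G' : PeirceLie f e φ)
    (F : Faithful e f) (F' : Faithful f e)
    (H : PeirceSplit e f φ d δ γ) (H' : PeirceSplit f e φ d δ γ) : IsDeriv d := by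
  have hd : ∀ i ∈ ({e, f} : Set A), ∀ j ∈ ({e, f} : Set A), ∀ x, InCorner i j x →
      InCorner i j (d x) := by
    simp only [Set.mem_insert_iff, Set.mem_singleton_iff, forall_eq_or_imp, forall_eq]
    exact ⟨⟨H.d_diag, H.d_off⟩, H'.d_off, H'.d_diag⟩
  have h0 : ∀ i ∈ ({e, f} : Set A), ∀ j ∈ ({e, f} : Set A), ∀ k ∈ ({e, f} : Set A),
      ∀ l ∈ ({e, f} : Set A), j * k = 0 → ∀ x y, InCorner i j x → InCorner k l y →
      d (x * y) = d x * y + x * d y := by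
    intro i hi j hj k hk l hl hjk x y hx hy
    rw [hx.mul_eq_zero hy hjk, (hd i hi j hj x hx).mul_eq_zero hy hjk,
      hx.mul_eq_zero (hd k hk l hl y hy) hjk, map_zero, add_zero]
  refine P.induction_pair (p := fun x y => d (x * y) = d x * y + x * d y) ?_ ?_ ?_
  · intro x x' y h h'
    rw [add_mul, map_add, h, h', map_add]; noncomm_ring
  · intro x y y' h h'
    rw [mul_add, map_add, h, h', map_add]; noncomm_ring
  · simp only [Set.mem_insert_iff, Set.mem_singleton_iff, forall_eq_or_imp, forall_eq, P.ef,
      P.fe, true_implies] at h0 ⊢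
    refine ⟨⟨⟨⟨?_, ?_⟩, h0.1.1.2⟩, h0.1.2.1, ?_, ?_⟩, ⟨⟨?_, ?_⟩, h0.2.1.2⟩, h0.2.2.1, ?_, ?_⟩
    · exact fun x y hx hy => H.mul_diag_diag P G G' F H' hx hy
    · exact fun x y hx hy => (H.mul_diag_off P G hx hy).1
    · exact fun x y hx hy => H.mul_off_off P G H' hx hy
    · exact fun x y hx hy => (H.mul_off_diag P G H' hx hy).1
    · exact fun x y hx hy => (H'.mul_off_diag P.symm G' H hx hy).1
    · exact fun x y hx hy => H'.mul_off_off P.symm G' H hx hy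
    · exact fun x y hx hy => (H'.mul_diag_off P.symm G' hx hy).1
    · exact fun x y hx hy => H'.mul_diag_diag P.symm G' G F' H hx hy

/-- The Jordan derivation identity for `δ` at the pair `x`, `y`. -/
def JordanAt (δ : A →ₗ[R] A) (x y : A) : Prop :=
  δ (x * y + y * x) = δ x * y + y * δ x + x * δ y + δ y * x

lemma JordanAt.symm {x y : A} (h : JordanAt δ x y) : JordanAt δ y x := by
  unfold JordanAt at h ⊢
  rw [add_comm, h]; abel

lemma PeirceSplit.jordanAt_diag_diag (H : PeirceSplit e f φ d δ γ) {a a' : A}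
    (ha : InCorner e e a) (ha' : InCorner e e a') : JordanAt δ a a' := by
  simp [JordanAt, H.δ_diag _ ha, H.δ_diag _ ha', H.δ_diag _ (ha.mul ha'), H.δ_diag _ (ha'.mul ha)]

lemma PeirceSplit.jordanAt_diag_diag' (P : Peirce e f) (H : PeirceSplit e f φ d δ γ)
    (H' : PeirceSplit f e φ d δ γ) {a b : A}
    (ha : InCorner e e a) (hb : InCorner f f b) : JordanAt δ a b := by
  simp [JordanAt, H.δ_diag _ ha, H'.δ_diag _ hb, ha.mul_eq_zero hb P.ef, hb.mul_eq_zero ha P.fe]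

lemma PeirceSplit.jordanAt_diag_off (P : Peirce e f) (G : PeirceLie e f φ)
    (H : PeirceSplit e f φ d δ γ) {a m : A}
    (ha : InCorner e e a) (hm : InCorner e f m) : JordanAt δ a m := by
  simp [JordanAt, H.δ_diag _ ha, hm.mul_eq_zero ha P.fe, (H.mul_diag_off P G ha hm).2,
    ha.mul_eq_zero (H.δ_off m hm) P.ef]

lemma PeirceSplit.jordanAt_off_diag (P : Peirce e f) (G : PeirceLie e f φ)
    (H : PeirceSplit e f φ d δ γ) (H' : PeirceSplit f e φ d δ γ) {m b : A}
    (hm : InCorner e f m) (hb : InCorner f f b) : JordanAt δ m b := by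
  simp [JordanAt, H'.δ_diag _ hb, hb.mul_eq_zero hm P.fe, (H.mul_off_diag P G H' hm hb).2,
    (H.δ_off m hm).mul_eq_zero hb P.ef]

lemma PeirceSplit.jordanAt_off_off (P : Peirce e f) (G : PeirceLie e f φ)
    (H : PeirceSplit e f φ d δ γ) {m m' : A}
    (hm : InCorner e f m) (hm' : InCorner e f m') : JordanAt δ m m' := by
  have h := H.δ_anticomm P G hm hm'
  rw [JordanAt, hm.mul_eq_zero hm' P.fe, hm'.mul_eq_zero hm P.fe, add_zero, map_zero]
  calc (0 : A) = (δ m * m' + δ m' * m) + (m * δ m' + m' * δ m) := by rw [h.1, h.2, add_zero]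
    _ = _ := by abel

lemma PeirceSplit.jordanAt_off_off' (P : Peirce e f)
    (H : PeirceSplit e f φ d δ γ) (H' : PeirceSplit f e φ d δ γ) {m t : A}
    (hm : InCorner e f m) (ht : InCorner f e t) : JordanAt δ m t := by
  simp [JordanAt, H.δ_diag _ (hm.mul ht), H'.δ_diag _ (ht.mul hm),
    (H.δ_off m hm).mul_eq_zero ht P.ef, ht.mul_eq_zero (H.δ_off m hm) P.ef,
    (H'.δ_off t ht).mul_eq_zero hm P.fe, hm.mul_eq_zero (H'.δ_off t ht) P.fe]

theorem PeirceSplit.isJordanDeriv (P : Peirce e f) (G : PeirceLie e f φ) (G' : PeirceLie f e φ)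
    (H : PeirceSplit e f φ d δ γ) (H' : PeirceSplit f e φ d δ γ) : IsJordanDeriv δ := by
  refine P.induction_pair (p := JordanAt δ) ?_ ?_ ?_
  · intro x x' y h h'
    unfold JordanAt at *
    rw [show (x + x') * y + y * (x + x') = (x * y + y * x) + (x' * y + y * x') by noncomm_ring,
      map_add, h, h', map_add]
    noncomm_ring
  · intro x y y' h h'
    unfold JordanAt at *
    rw [show x * (y + y') + (y + y') * x = (x * y + y * x) + (x * y' + y' * x) by noncomm_ring,
      map_add, h, h', map_add]
    noncomm_ring
  · simp only [Set.mem_insert_iff, Set.mem_singleton_iff, forall_eq_or_imp, forall_eq]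
    refine ⟨⟨⟨⟨?_, ?_⟩, ?_, ?_⟩, ⟨?_, ?_⟩, ?_, ?_⟩, ⟨⟨?_, ?_⟩, ?_, ?_⟩, ⟨?_, ?_⟩, ?_, ?_⟩
    · exact fun x y hx hy => H.jordanAt_diag_diag hx hy
    · exact fun x y hx hy => H.jordanAt_diag_off P G hx hy
    · exact fun x y hx hy => (H'.jordanAt_off_diag P.symm G' H hy hx).symm
    · exact fun x y hx hy => H.jordanAt_diag_diag' P H' hx hy
    · exact fun x y hx hy => (H.jordanAt_diag_off P G hy hx).symm
    · exact fun x y hx hy => H.jordanAt_off_off P G hx hy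
    · exact fun x y hx hy => H.jordanAt_off_off' P H' hx hy
    · exact fun x y hx hy => H.jordanAt_off_diag P G H' hx hy
    · exact fun x y hx hy => H'.jordanAt_off_diag P.symm G' H hx hy
    · exact fun x y hx hy => H'.jordanAt_off_off' P.symm H hx hy
    · exact fun x y hx hy => H'.jordanAt_off_off P.symm G' hx hy
    · exact fun x y hx hy => (H'.jordanAt_diag_off P.symm G' hy hx).symm
    · exact fun x y hx hy => H'.jordanAt_diag_diag' P.symm H hx hy
    · exact fun x y hx hy => (H.jordanAt_off_diag P G H' hy hx).symm
    · exact fun x y hx hy => H'.jordanAt_diag_off P.symm G' hx hy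
    · exact fun x y hx hy => H'.jordanAt_diag_diag hx hy

end Split

section Centre

variable {e f : A}

lemma IsCent.sub {z w : A} (hz : IsCent z) (hw : IsCent w) : IsCent (z - w) := fun y => by
  rw [sub_mul, mul_sub, hz y, hw y]

lemma IsCent.add {z w : A} (hz : IsCent z) (hw : IsCent w) : IsCent (z + w) := fun y => by
  rw [add_mul, mul_add, hz y, hw y]

lemma IsCent.sandwich_eq_zero (P : Peirce e f) {z : A} (hz : IsCent z) : e * z * f = 0 := by
  rw [mul_assoc, hz f, ← mul_assoc, P.ef, zero_mul]

lemma IsCent.eq_zero (P : Peirce e f) (F : Faithful e f) {z : A} (hz : IsCent z)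
    (h : f * z * f = 0) : z = 0 := by
  have h1 : e * z * e = 0 := by
    refine F _ (.mk' P.ee P.ee z) (fun m hm => ?_) fun t ht => ?_
    · calc e * z * e * m = e * z * m := by rw [mul_assoc, hm.1]
        _ = e * m * z := by rw [mul_assoc, hz m, mul_assoc]
        _ = m * (f * f) * z := by rw [hm.1, P.ff, hm.2]
        _ = m * (f * (z * f)) := by rw [hz f]; noncomm_ring
        _ = 0 := by rw [← mul_assoc f, h, mul_zero]
    · calc t * (e * z * e) = t * e * z * e := by noncomm_ring
        _ = z * t * e := by rw [ht.2, hz t]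
        _ = z * (f * f) * t := by rw [P.ff, mul_assoc, ht.2, mul_assoc, ht.1]
        _ = f * z * f * t := by rw [← hz f]; noncomm_ring
        _ = 0 := by rw [h, zero_mul]
  rw [P.decomp z, h1, h, hz.sandwich_eq_zero P, hz.sandwich_eq_zero P.symm]
  simp

lemma comm_diag_of_comm_off (P : Peirce e f) (F : Faithful e f) {z : A}
    (h1 : e * z * f = 0) (h2 : f * z * e = 0) (hm : ∀ m, InCorner e f m → z * m = m * z)
    (ht : ∀ t, InCorner f e t → z * t = t * z) {a : A} (ha : InCorner e e a) :
    z * a = a * z := by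
  have hze : z * e = e * z * e := by
    calc z * e = (e + f) * z * e := by rw [P.add, one_mul]
      _ = _ := by rw [add_mul, add_mul, h2, add_zero]
  have hez : e * z = e * z * e := by
    calc e * z = e * z * (e + f) := by rw [P.add, mul_one]
      _ = _ := by rw [mul_add, h1, add_zero]
  have hcomm : z * e = e * z := hze.trans hez.symm
  rw [← sub_eq_zero]
  refine F _ ⟨?_, ?_⟩ (fun m h => ?_) fun t h => ?_
  · rw [mul_sub, ← mul_assoc, ← hcomm, mul_assoc, ha.1, ← mul_assoc, ha.1]
  · rw [sub_mul, mul_assoc, ha.2, mul_assoc, hcomm, ← mul_assoc, ha.2]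
  · rw [sub_mul, mul_assoc, hm _ (ha.mul h), mul_assoc a z, hm _ h, mul_assoc, sub_self]
  · rw [mul_sub, ← mul_assoc, ← ht _ h, mul_assoc z, ht _ (h.mul ha), ← mul_assoc, sub_self]

lemma isCent_of_comm_off (P : Peirce e f) (F : Faithful e f) (F' : Faithful f e) {z : A}
    (h1 : e * z * f = 0) (h2 : f * z * e = 0) (hm : ∀ m, InCorner e f m → z * m = m * z)
    (ht : ∀ t, InCorner f e t → z * t = t * z) : IsCent z := by
  intro y
  rw [P.decomp y]
  simp only [mul_add, add_mul]
  rw [hm _ (.mk' P.ee P.ff y), ht _ (.mk' P.ff P.ee y),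
    comm_diag_of_comm_off P F h1 h2 hm ht (.mk' P.ee P.ee y),
    comm_diag_of_comm_off P.symm F' h2 h1 ht hm (.mk' P.ff P.ff y)]

lemma LinearMap.exists_comp_eq_of_injective {M N Z : Type*} [AddCommGroup M] [AddCommGroup N]
    [AddCommGroup Z] [Module R M] [Module R N] [Module R Z] (g : M →ₗ[R] N) (ψ : Z →ₗ[R] N)
    (hψ : Function.Injective ψ) (h : ∀ x, ∃ z, ψ z = g x) : ∃ k : M →ₗ[R] Z, ∀ x, ψ (k x) = g x := by
  refine ⟨(LinearEquiv.ofInjective ψ hψ).symm.toLinearMap ∘ₗ g.codRestrict (LinearMap.range ψ) h,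
    fun x => ?_⟩
  have := LinearEquiv.apply_symm_apply (LinearEquiv.ofInjective ψ hψ)
    (g.codRestrict (LinearMap.range ψ) h x)
  exact congrArg Subtype.val this

lemma exists_central_lift (P : Peirce e f) (F : Faithful e f) (φ : A →ₗ[R] A)
    (h : ∀ a, ∃ z, IsCent z ∧ f * φ (e * a * e) * f = f * z * f) :
    ∃ γ : A →ₗ[R] A, (∀ x, IsCent (γ x)) ∧ ∀ x, f * φ (e * x * e) * f = f * γ x * f := by
  have hcent : ∀ z : (Subalgebra.center R A).toSubmodule, IsCent (z : A) := fun z y =>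
    ((Subalgebra.mem_center_iff (R := R) (A := A)).1 z.2 y).symm
  obtain ⟨k, hk⟩ := LinearMap.exists_comp_eq_of_injective
    (LinearMap.mulLeftRight R (f, f) ∘ₗ φ ∘ₗ LinearMap.mulLeftRight R (e, e))
    (LinearMap.mulLeftRight R (f, f) ∘ₗ (Subalgebra.center R A).toSubmodule.subtype)
    (by
      rw [injective_iff_map_eq_zero]
      intro z hz
      exact Subtype.ext ((hcent z).eq_zero P F (by simpa using hz)))
    (fun x => by
      obtain ⟨z, hz, hz'⟩ := h x
      exact ⟨⟨z, (Subalgebra.mem_center_iff (R := R) (A := A)).2 fun y => (hz y).symm⟩, by simp [hz']⟩)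
  exact ⟨Submodule.subtype _ ∘ₗ k, fun x => hcent (k x), fun x => by simpa using (hk x).symm⟩

end Centre

section Existence

variable {e f : A} {φ : A →ₗ[R] A}

lemma peirceSplit_of_eq (P : Peirce e f) (G : PeirceLie e f φ) (F : Faithful e f)
    (F' : Faithful f e) {δ γ : A →ₗ[R] A} (hγ : ∀ x, IsCent (γ x))
    (hγe : ∀ a, InCorner e e a → f * φ a * f = f * γ a * f)
    (hγf : ∀ b, InCorner f f b → e * φ b * e = e * γ b * e)
    (hγm : ∀ m, InCorner e f m → γ m = 0)
    (hδe : ∀ a, InCorner e e a → δ a = 0)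
    (hδm : ∀ m, InCorner e f m → δ m = f * φ m * e)
    (hc : ∀ m t, InCorner e f m → InCorner f e t →
      IsCent (e * φ (t * m) * e + f * φ (m * t) * f)) :
    PeirceSplit e f φ (φ - δ - γ) δ γ where
  eq x := by simp only [LinearMap.sub_apply]; abel
  cent := hγ
  d_diag a ha := by
    have : (φ - δ - γ) a = e * (φ a - γ a) * e := by
      simp only [LinearMap.sub_apply, hδe a ha, sub_zero]
      conv_lhs => rw [P.decomp (φ a), P.decomp (γ a)]
      rw [(G.diag a ha).1, (G.diag a ha).2, (hγ a).sandwich_eq_zero P,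
        (hγ a).sandwich_eq_zero P.symm, hγe a ha]
      noncomm_ring
    rw [this]
    exact .mk' P.ee P.ee _
  d_off m hm := by
    have : (φ - δ - γ) m = e * φ m * f := by
      simp only [LinearMap.sub_apply, hδm m hm, hγm m hm, sub_zero]
      have h := P.decomp (φ m)
      rw [(G.off m hm).1, (G.off m hm).2, zero_add, add_zero] at h
      rw [sub_eq_iff_eq_add, ← h]
    rw [this]
    exact .mk' P.ee P.ff _
  δ_diag := hδe
  δ_off m hm := by
    rw [hδm m hm]
    exact .mk' P.ff P.ee _
  γ_off := hγm
  γ_comm m t hm ht := by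
    have h := hc m t hm ht
    rw [hγf _ (ht.mul hm), hγe _ (hm.mul ht)] at h
    have r1 : ∀ z, e * (e * z) = e * z := fun z => by rw [← mul_assoc, P.ee]
    have r2 : ∀ z, f * (f * z) = f * z := fun z => by rw [← mul_assoc, P.ff]
    have r3 : ∀ z, e * (f * z) = 0 := fun z => by rw [← mul_assoc, P.ef, zero_mul]
    have r4 : ∀ z, f * (e * z) = 0 := fun z => by rw [← mul_assoc, P.fe, zero_mul]
    have h1 := (h.sub (hγ (t * m))).eq_zero P.symm F' (by
      simp [mul_add, mul_sub, sub_mul, mul_assoc, r1, r3, P.ee])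
    refine sub_eq_zero.1 (((hγ (m * t)).sub (hγ (t * m))).eq_zero P F ?_)
    have h2 := congrArg (fun z => f * z * f) h1
    simpa [mul_add, add_mul, mul_sub, sub_mul, mul_assoc, r2, r4, P.ff, P.ef] using h2

theorem exists_peirceSplit (P : Peirce e f) (G : PeirceLie e f φ) (G' : PeirceLie f e φ)
    (F : Faithful e f) (F' : Faithful f e)
    (he : ∀ a, ∃ z, IsCent z ∧ f * φ (e * a * e) * f = f * z * f)
    (hf : ∀ b, ∃ z, IsCent z ∧ e * φ (f * b * f) * e = e * z * e)
    (hc : ∀ m t, InCorner e f m → InCorner f e t →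
      IsCent (e * φ (t * m) * e + f * φ (m * t) * f)) :
    ∃ d δ γ : A →ₗ[R] A, PeirceSplit e f φ d δ γ ∧ PeirceSplit f e φ d δ γ ∧
      ∀ x, δ x = f * φ (e * x * f) * e + e * φ (f * x * e) * f := by
  obtain ⟨γ₁, h1, h1'⟩ := exists_central_lift P F φ he
  obtain ⟨γ₂, h2, h2'⟩ := exists_central_lift P.symm F' φ hf
  let δ : A →ₗ[R] A :=
    LinearMap.mulLeftRight R (f, e) ∘ₗ φ ∘ₗ LinearMap.mulLeftRight R (e, f) +
    LinearMap.mulLeftRight R (e, f) ∘ₗ φ ∘ₗ LinearMap.mulLeftRight R (f, e)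
  have hδ : ∀ x, δ x = f * φ (e * x * f) * e + e * φ (f * x * e) * f := fun x => by simp [δ]
  have z1 : ∀ x, e * x * e = 0 → γ₁ x = 0 := fun x hx => (h1 x).eq_zero P F (by
    rw [← h1', hx]; simp)
  have z2 : ∀ x, f * x * f = 0 → γ₂ x = 0 := fun x hx => (h2 x).eq_zero P.symm F' (by
    rw [← h2', hx]; simp)
  have cent : ∀ x, IsCent ((γ₁ + γ₂) x) := fun x => (h1 x).add (h2 x)
  have ge : ∀ a, InCorner e e a → f * φ a * f = f * (γ₁ + γ₂) a * f := fun a ha => by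
    rw [LinearMap.add_apply, z2 a (by rw [← ha.1, ← mul_assoc, P.fe]; simp), add_zero, ← h1',
      ha.sandwich]
  have gf : ∀ b, InCorner f f b → e * φ b * e = e * (γ₁ + γ₂) b * e := fun b hb => by
    rw [LinearMap.add_apply, z1 b (by rw [← hb.1, ← mul_assoc, P.ef]; simp), zero_add, ← h2',
      hb.sandwich]
  have gm : ∀ m, InCorner e f m → (γ₁ + γ₂) m = 0 := fun m hm => by
    rw [LinearMap.add_apply, z1 m (by rw [← hm.2]; simp [mul_assoc, P.fe]),
      z2 m (by rw [← hm.1, ← mul_assoc, P.fe]; simp), add_zero]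
  have gt : ∀ t, InCorner f e t → (γ₁ + γ₂) t = 0 := fun t ht => by
    rw [LinearMap.add_apply, z1 t (by rw [← ht.1, ← mul_assoc, P.ef]; simp),
      z2 t (by rw [← ht.2]; simp [mul_assoc, P.ef]), add_zero]
  refine ⟨_, δ, γ₁ + γ₂, peirceSplit_of_eq P G F F' cent ge gf gm ?_ ?_ hc,
    peirceSplit_of_eq P.symm G' F' F cent gf ge gt ?_ ?_ ?_, hδ⟩
  · intro a ha
    rw [hδ, (ha.rules P.fe P.ef).2.2.1, ha.1, (ha.rules P.fe P.ef).2.2.2.1]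
    simp
  · intro m hm
    rw [hδ, hm.sandwich, (hm.rules P.fe P.fe).2.2.1]
    simp
  · intro b hb
    rw [hδ, (hb.rules P.ef P.fe).2.2.1, hb.1, (hb.rules P.ef P.fe).2.2.2.1]
    simp
  · intro t ht
    rw [hδ, ht.sandwich, (ht.rules P.ef P.ef).2.2.1]
    simp
  · intro t m ht hm
    rw [add_comm]
    exact hc m t hm ht

end Existence

section LieToPeirce

variable {e f : A} {φ : A →ₗ[R] A}

/-- The map `x ↦ [x, e]`. -/
def bracketWith (e x : A) : A := x * e - e * x

lemma iterate_bracketWith_left (P : Peirce e f) (N : ℕ) (w : A) :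
    e * (bracketWith e)^[N] w * f = (-1 : ℤ) ^ N • (e * w * f) := by
  induction N with
  | zero => simp
  | succ N ih =>
    have : ∀ v, e * bracketWith e v * f = -(e * v * f) := fun v => by
      have r : e * (e * (v * f)) = e * (v * f) := by rw [← mul_assoc, P.ee]
      simp [bracketWith, mul_sub, sub_mul, mul_assoc, P.ef, r]
    rw [Function.iterate_succ_apply', this, ih, pow_succ]
    simp

lemma iterate_bracketWith_right (P : Peirce e f) (N : ℕ) (w : A) :
    f * (bracketWith e)^[N] w * e = f * w * e := by
  induction N with
  | zero => simp
  | succ N ih =>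
    have : ∀ v, f * bracketWith e v * e = f * v * e := fun v => by
      have r : f * (e * (v * e)) = 0 := by rw [← mul_assoc, P.fe, zero_mul]
      simp [bracketWith, mul_sub, sub_mul, mul_assoc, P.ee, r]
    rw [Function.iterate_succ_apply', this, ih]

lemma iterate_bracketWith_diag (P : Peirce e f) (N : ℕ) {w : A} (h : e * w * e = 0)
    (h' : f * w * f = 0) :
    e * (bracketWith e)^[N] w * e = 0 ∧ f * (bracketWith e)^[N] w * f = 0 := by
  induction N with
  | zero => exact ⟨h, h'⟩
  | succ N ih =>
    rw [Function.iterate_succ_apply']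
    generalize (bracketWith e)^[N] w = v
    have r1 : e * (e * (v * e)) = e * (v * e) := by rw [← mul_assoc, P.ee]
    have r2 : f * (e * (v * f)) = 0 := by rw [← mul_assoc, P.fe, zero_mul]
    simp [bracketWith, mul_sub, sub_mul, mul_assoc, P.ee, P.ef, r1, r2]

lemma iterate_bracketWith_of_offdiag (P : Peirce e f) (N : ℕ) {w : A} (h : e * w * e = 0)
    (h' : f * w * f = 0) :
    (bracketWith e)^[N] w = (-1 : ℤ) ^ N • (e * w * f) + f * w * e := by
  rw [P.decomp ((bracketWith e)^[N] w), iterate_bracketWith_left P, iterate_bracketWith_right P,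
    (iterate_bracketWith_diag P N h h').1, (iterate_bracketWith_diag P N h h').2]
  simp

lemma bracketWith_diag (P : Peirce e f) (w : A) :
    e * bracketWith e w * e = 0 ∧ f * bracketWith e w * f = 0 := by
  have r1 : e * (e * (w * e)) = e * (w * e) := by rw [← mul_assoc, P.ee]
  have r2 : f * (e * (w * f)) = 0 := by rw [← mul_assoc, P.fe, zero_mul]
  simp [bracketWith, mul_sub, sub_mul, mul_assoc, P.ee, P.ef, r1, r2]

lemma iterate_bracketWith_corner (P : Peirce e f) (N : ℕ) {m : A} (hm : InCorner e f m) :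
    (bracketWith e)^[N] m = (-1 : ℤ) ^ N • m := by
  have r := hm.rules P.fe P.fe
  rw [iterate_bracketWith_of_offdiag P N (by rw [r.1, r.2.2.2.1]) (by rw [r.2.2.1, zero_mul]),
    hm.sandwich, r.2.2.1, zero_mul, add_zero]

lemma iterate_bracketWith_corner' (P : Peirce e f) (N : ℕ) {t : A} (ht : InCorner f e t) :
    (bracketWith e)^[N] t = t := by
  have r := ht.rules P.ef P.ef
  rw [iterate_bracketWith_of_offdiag P N (by rw [r.2.2.1, zero_mul]) (by rw [r.1, r.2.2.2.1]),
    ht.sandwich, r.2.2.1, zero_mul, smul_zero, zero_add]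

lemma iterate_bracketWith_compl (P : Peirce e f) (N : ℕ) (x : A) :
    (bracketWith f)^[N] x = (-1 : ℤ) ^ N • (bracketWith e)^[N] x := by
  induction N with
  | zero => simp
  | succ N ih =>
    have hf : f = 1 - e := by rw [← P.add]; abel
    have h1 : ∀ v, bracketWith f v = -bracketWith e v := fun v => by
      rw [hf]; unfold bracketWith; noncomm_ring
    rw [Function.iterate_succ_apply', Function.iterate_succ_apply', ih, h1, pow_succ]
    rcases neg_one_pow_eq_or ℤ N with h | h
    · simp [h]
    · have hneg : ∀ v, bracketWith e (-v) = -bracketWith e v := fun v => by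
        unfold bracketWith; noncomm_ring
      simp [h, hneg]

/-- The instances of the Lie `(N + 2)`-derivation identity with all but two arguments equal
to `e`, for `φ e` central. -/
structure BracketLie (e : A) (N : ℕ) (φ : A →ₗ[R] A) : Prop where
  outer : ∀ x y, φ ((bracketWith e)^[N] (x * y - y * x)) =
    (bracketWith e)^[N] (φ x * y - y * φ x + (x * φ y - φ y * x))
  inner : ∀ x y, φ ((bracketWith e)^[N] x * y - y * (bracketWith e)^[N] x) =
    (bracketWith e)^[N] (φ x) * y - y * (bracketWith e)^[N] (φ x) +
      ((bracketWith e)^[N] x * φ y - φ y * (bracketWith e)^[N] x)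
  self : ∀ x, φ ((bracketWith e)^[N + 1] x) = (bracketWith e)^[N + 1] (φ x)

lemma BracketLie.compl (P : Peirce e f) {N : ℕ} (B : BracketLie e N φ) : BracketLie f N φ where
  outer x y := by
    rw [iterate_bracketWith_compl P, iterate_bracketWith_compl P, map_zsmul, B.outer]
  inner x y := by
    have := B.inner x y
    rw [iterate_bracketWith_compl P, iterate_bracketWith_compl P]
    rcases neg_one_pow_eq_or ℤ N with h | h
    · simpa [h] using this
    · have := congrArg Neg.neg this
      rw [← map_neg] at this
      simp only [h, neg_smul, one_smul]
      convert this using 1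
      · congr 1; noncomm_ring
      · noncomm_ring
  self x := by
    rw [iterate_bracketWith_compl P, iterate_bracketWith_compl P, map_zsmul, B.self]

lemma BracketLie.map_right_eq (P : Peirce e f) {N : ℕ} (B : BracketLie e N φ) {m : A}
    (hm : InCorner e f m) : (-1 : ℤ) ^ (N + 1) • (f * φ m * e) = f * φ m * e := by
  have h := congrArg (fun z => f * z * e) (B.self m)
  simpa only [iterate_bracketWith_corner P _ hm, iterate_bracketWith_right P, map_zsmul,
    mul_smul_comm, smul_mul_assoc] using h

lemma BracketLie.map_right_eq_zero (P : Peirce e f) (h2 : TorsionFreeAt A 2) {N : ℕ}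
    (hN : Even N) (B : BracketLie e N φ) {m : A} (hm : InCorner e f m) : f * φ m * e = 0 := by
  have h := B.map_right_eq P hm
  rw [hN.add_one.neg_one_pow, neg_smul, one_smul] at h
  refine h2 _ ?_
  rw [two_nsmul]
  nth_rewrite 1 [← h]
  exact neg_add_cancel _

lemma BracketLie.peirceLie (P : Peirce e f) {N : ℕ} (B : BracketLie e N φ) :
    PeirceLie e f φ := by
  have hoff : ∀ m, InCorner e f m → e * φ m * e = 0 ∧ f * φ m * f = 0 := by
    intro m hm
    have h := B.self m
    rw [iterate_bracketWith_corner P _ hm, map_zsmul, Function.iterate_succ_apply] at h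
    have h' := iterate_bracketWith_diag P N (bracketWith_diag P (φ m)).1
      (bracketWith_diag P (φ m)).2
    rw [← h] at h'
    rcases neg_one_pow_eq_or ℤ (N + 1) with hs | hs <;> simpa [hs] using h'
  refine ⟨hoff, fun a ha => ?_, fun x y hxy => ?_, fun m y hm => ?_⟩
  · have h := B.self a
    have h0 : (bracketWith e)^[N + 1] a = 0 := by
      rw [Function.iterate_succ_apply, show bracketWith e a = 0 by
        rw [bracketWith, ha.1, ha.2, sub_self],
        iterate_bracketWith_of_offdiag P N (by simp) (by simp)]
      simp
    rw [h0, map_zero] at h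
    have h1 := iterate_bracketWith_left P (N + 1) (φ a)
    have h2 := iterate_bracketWith_right P (N + 1) (φ a)
    rw [← h] at h1 h2
    constructor
    · rcases neg_one_pow_eq_or ℤ (N + 1) with hs | hs <;> simpa [hs] using h1.symm
    · simpa using h2.symm
  · have h := B.outer x y
    rw [iterate_bracketWith_corner P _ hxy, map_zsmul] at h
    have h1 := congrArg (fun z => e * z * f) h
    have h2 := congrArg (fun z => f * z * e) h
    simp only [iterate_bracketWith_left P, iterate_bracketWith_right P, mul_smul_comm,
      smul_mul_assoc] at h1 h2
    have h3 := B.map_right_eq P hxy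
    rw [pow_succ, mul_neg_one, neg_smul] at h3
    rw [← h2]
    constructor
    · rcases neg_one_pow_eq_or ℤ N with hs | hs <;> simpa [hs] using h1
    · rw [neg_eq_iff_eq_neg, h3]
  · have h := B.inner m y
    have h3 := B.map_right_eq P hm
    rw [iterate_bracketWith_corner P _ hm,
      iterate_bracketWith_of_offdiag P N (hoff m hm).1 (hoff m hm).2] at h
    rw [pow_succ, mul_neg_one] at h3
    rcases neg_one_pow_eq_or ℤ N with hs | hs
    · rw [hs] at h h3
      simp only [neg_smul, one_smul] at h h3
      rw [h, sub_eq_add_neg (e * φ m * f), h3]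
    · rw [hs] at h
      simp only [neg_smul, one_smul] at h
      have h' := congrArg Neg.neg h
      rw [← map_neg] at h'
      convert h' using 1
      · congr 1; noncomm_ring
      · noncomm_ring

lemma isCent_map_idempotent (P : Peirce e f) (F : Faithful e f) (F' : Faithful f e) {k : ℕ}
    (hk : TorsionFreeAt A k) (hφ : IsLieNDeriv (k + 1) φ)
    (h1 : e * φ e * f = 0) (h2 : f * φ e * e = 0) : IsCent (φ e) := by
  rw [isLieNDeriv_iff] at hφ
  set u := φ e
  have hu : u = e * u * e + f * u * f := by
    conv_lhs => rw [P.decomp u, h1, h2]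
    simp
  let s : A → ℕ → A := fun x i => if i = 0 then x else e
  have hs : ∀ x k, pCom (s x) k = (bracketWith e)^[k] x := by
    intro x k
    induction k with
    | zero => rfl
    | succ k ih => rw [Function.iterate_succ_apply', ← ih]; rfl
  have hl : ∀ x k, pLeib φ (s x) (k + 1) = bracketWith e (pLeib φ (s x) k) +
      ((bracketWith e)^[k] x * u - u * (bracketWith e)^[k] x) := by
    intro x k
    rw [← hs]; rfl
  have hue : e * u = u * e := by
    rw [hu]
    simp only [mul_add, add_mul, ← mul_assoc, P.ee, P.ef]
    simp only [mul_assoc, P.ee, P.fe]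
    simp
  have huf : f * u = u * f := by
    rw [hu]
    simp only [mul_add, add_mul, ← mul_assoc, P.ff, P.fe]
    simp only [mul_assoc, P.ff, P.ef]
    simp
  refine isCent_of_comm_off P F F' h1 h2 (fun m hm => ?_) fun t ht => ?_
  · have hc : e * (m * u - u * m) * f = m * u - u * m := by
      rw [mul_sub, sub_mul, ← mul_assoc, hm.1, mul_assoc, ← huf, ← mul_assoc, hm.2,
        ← mul_assoc, hue, mul_assoc u, hm.1, mul_assoc u, hm.2]
    have hj : ∀ j : ℕ, e * pLeib φ (s m) j * f =
        (-1 : ℤ) ^ j • (e * φ m * f - j • (m * u - u * m)) := by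
      intro j
      induction j with
      | zero => simp [pLeib, s]
      | succ j ih =>
        have hb := iterate_bracketWith_left P 1 (pLeib φ (s m) j)
        rw [Function.iterate_one, ih, pow_one, neg_one_smul] at hb
        rw [hl, mul_add, add_mul, hb, iterate_bracketWith_corner P j hm, smul_mul_assoc,
          mul_smul_comm, ← smul_sub, mul_smul_comm, smul_mul_assoc, hc, pow_succ, succ_nsmul]
        generalize m * u - u * m = w
        rcases neg_one_pow_eq_or ℤ j with h | h <;> rw [h] <;> module
    have h := congrArg (fun z => e * z * f) (hφ (s m))
    simp only [hs, hj, iterate_bracketWith_corner P _ hm, map_zsmul, mul_smul_comm,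
      smul_mul_assoc] at h
    have h0 : k • (m * u - u * m) = 0 := by
      rcases neg_one_pow_eq_or ℤ k with hp | hp
      · rw [hp, one_smul, one_smul] at h
        exact sub_eq_self.1 h.symm
      · rw [hp, neg_smul, neg_smul, one_smul, one_smul, neg_inj] at h
        exact sub_eq_self.1 h.symm
    exact (sub_eq_zero.1 (hk _ h0)).symm
  · have hc : f * (t * u - u * t) * e = t * u - u * t := by
      rw [mul_sub, sub_mul, ← mul_assoc, ht.1, mul_assoc, ← hue, ← mul_assoc, ht.2,
        ← mul_assoc, huf, mul_assoc u, ht.1, mul_assoc u, ht.2]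
    have hj : ∀ j : ℕ, f * pLeib φ (s t) j * e = f * φ t * e + j • (t * u - u * t) := by
      intro j
      induction j with
      | zero => simp [pLeib, s]
      | succ j ih =>
        have hb := iterate_bracketWith_right P 1 (pLeib φ (s t) j)
        rw [Function.iterate_one, ih] at hb
        rw [hl, mul_add, add_mul, hb, iterate_bracketWith_corner' P j ht, hc, succ_nsmul,
          add_assoc]
    have h := congrArg (fun z => f * z * e) (hφ (s t))
    simp only [hs, hj, iterate_bracketWith_corner' P _ ht] at h
    exact (sub_eq_zero.1 (hk _ (left_eq_add.1 h))).symm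

lemma IsLieNDeriv.bracketLie {N : ℕ} (hφ : IsLieNDeriv (N + 2) φ) (hu : IsCent (φ e)) :
    BracketLie e N φ := by
  rw [isLieNDeriv_iff] at hφ
  have outer : ∀ x y, φ ((bracketWith e)^[N] (x * y - y * x)) =
      (bracketWith e)^[N] (φ x * y - y * φ x + (x * φ y - φ y * x)) := by
    intro x y
    let s : ℕ → A := fun i => if i = 0 then x else if i = 1 then y else e
    have hs : ∀ k, pCom s (k + 1) = (bracketWith e)^[k] (x * y - y * x) := by
      intro k
      induction k with
      | zero => rfl
      | succ k ih => rw [Function.iterate_succ_apply', ← ih]; rfl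
    have hl : ∀ k, pLeib φ s (k + 1) =
        (bracketWith e)^[k] (φ x * y - y * φ x + (x * φ y - φ y * x)) := by
      intro k
      induction k with
      | zero => rfl
      | succ k ih =>
        have : s (k + 1 + 1) = e := rfl
        rw [Function.iterate_succ_apply', ← ih, pLeib, this, hu, sub_self, add_zero]; rfl
    rw [← hs, ← hl, hφ]
  refine ⟨outer, fun x y => ?_, fun x => ?_⟩
  · let s : ℕ → A := fun i => if i = 0 then x else if i = N + 1 then y else e
    have hse : ∀ k, k < N → s (k + 1) = e := fun k hk => by
      simp only [s]
      rw [if_neg (by omega), if_neg (by omega)]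
    have hsN : s (N + 1) = y := by simp [s]
    have hs : ∀ k ≤ N, pCom s k = (bracketWith e)^[k] x := by
      intro k hk
      induction k with
      | zero => rfl
      | succ k ih =>
        rw [Function.iterate_succ_apply', ← ih (by omega), pCom, hse k (by omega)]; rfl
    have hl : ∀ k ≤ N, pLeib φ s k = (bracketWith e)^[k] (φ x) := by
      intro k hk
      induction k with
      | zero => rfl
      | succ k ih =>
        rw [Function.iterate_succ_apply', ← ih (by omega), pLeib, hse k (by omega), hu, sub_self,
          add_zero]; rfl
    have h := hφ s
    rwa [pCom, pLeib, hsN, hs N le_rfl, hl N le_rfl] at h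
  · have h := outer x e
    rw [hu, sub_self, add_zero] at h
    exact h

end LieToPeirce

lemma PeirceSplit.isSingularJordanDeriv {e f : A} {φ d δ γ : A →ₗ[R] A} (P : Peirce e f)
    (hf : f = 1 - e) (G : PeirceLie e f φ) (G' : PeirceLie f e φ) (H : PeirceSplit e f φ d δ γ)
    (H' : PeirceSplit f e φ d δ γ) : IsSingularJordanDeriv e δ := by
  subst hf
  refine ⟨H.isJordanDeriv P G G' H', fun a => H.δ_diag _ (.mk' P.ee P.ee a),
    fun b => H'.δ_diag _ (.mk' P.ff P.ff b), fun m => ?_, fun t => ?_⟩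
  · exact (H.δ_off _ (.mk' P.ee P.ff m)).sandwich.symm
  · exact (H'.δ_off _ (.mk' P.ff P.ee t)).sandwich.symm

lemma PeirceSplit.vanishesOnNCommutators {e f : A} {φ d δ γ : A →ₗ[R] A} {k : ℕ}
    (hφ : IsLieNDeriv (k + 2) φ) (H : PeirceSplit e f φ d δ γ) (hd : IsDeriv d)
    (hδ : IsJordanDeriv δ) (h0 : Even k → δ = 0) : VanishesOnNCommutators (k + 2) γ := by
  intro x
  change γ (pCom x (k + 1)) = 0
  have hsum : φ = d + δ + γ := LinearMap.ext H.eq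
  have hL := (isLieNDeriv_iff φ).1 hφ x
  have hδL : δ (pCom x (k + 1)) = pLeib δ x (k + 1) := by
    rcases Nat.even_or_odd k with hk | hk
    · rw [h0 hk, pLeib_of_isCent fun _ _ => by simp]; simp
    · obtain ⟨j, hj⟩ := hk.add_one.two_dvd
      rw [hj, hδ.map_pCom]
  rw [hsum, pLeib_add, pLeib_add, pLeib_of_isCent H.cent, LinearMap.add_apply,
    LinearMap.add_apply, hd.map_pCom, hδL, add_zero] at hL
  simpa using hL

/-- The sufficiency of the two conditions when `φ e` has no off-diagonal part. -/
theorem exists_decomposition_of_diag {n : ℕ} (hn : 2 ≤ n) (h2 : TorsionFreeAt A 2)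
    (hn1 : TorsionFreeAt A (n - 1)) {e f : A} (P : Peirce e f) (hf : f = 1 - e)
    (F : Faithful e f) (F' : Faithful f e) {φ : A →ₗ[R] A} (hφ : IsLieNDeriv n φ)
    (h1 : e * φ e * f = 0) (h1' : f * φ e * e = 0)
    (hce : ∀ a, ∃ z, IsCent z ∧ f * φ (e * a * e) * f = f * z * f)
    (hcf : ∀ b, ∃ z, IsCent z ∧ e * φ (f * b * f) * e = e * z * e)
    (hc : ∀ m t, InCorner e f m → InCorner f e t →
      IsCent (e * φ (t * m) * e + f * φ (m * t) * f)) :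
    ∃ d δ γ : A →ₗ[R] A, IsDeriv d ∧ IsSingularJordanDeriv e δ ∧
      (∀ x : A, IsCent (γ x)) ∧ VanishesOnNCommutators n γ ∧ φ = d + δ + γ := by
  obtain ⟨k, rfl⟩ := Nat.exists_eq_add_of_le' hn
  have hu := isCent_map_idempotent P F F' (k := k + 1) hn1 hφ h1 h1'
  have B := hφ.bracketLie hu
  have B' := B.compl P
  have G := B.peirceLie P
  have G' := B'.peirceLie P.symm
  obtain ⟨d, δ, γ, H, H', hδ⟩ := exists_peirceSplit P G G' F F' hce hcf hc
  have hd := H.isDeriv P G G' F F' H'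
  refine ⟨d, δ, γ, hd, H.isSingularJordanDeriv P hf G G' H', H.cent,
    H.vanishesOnNCommutators hφ hd (H.isJordanDeriv P G G' H') fun hk => ?_,
    LinearMap.ext H.eq⟩
  ext x
  rw [hδ, B.map_right_eq_zero P h2 hk (.mk' P.ee P.ff x),
    B'.map_right_eq_zero P.symm h2 hk (.mk' P.ff P.ee x)]
  simp

/-- The inner derivation `x ↦ [x, s]`. -/
def innerDeriv (R : Type*) {A : Type*} [CommRing R] [Ring A] [Algebra R A] (s : A) : A →ₗ[R] A :=
  LinearMap.mulRight R s - LinearMap.mulLeft R s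

lemma innerDeriv_apply (s x : A) : innerDeriv R s x = x * s - s * x := by
  simp [innerDeriv]

lemma isDeriv_innerDeriv (s : A) : IsDeriv (innerDeriv R s) := fun x y => by
  simp only [innerDeriv_apply]; noncomm_ring

lemma IsLieNDeriv.sub_isDeriv {n : ℕ} (hn : 2 ≤ n) {φ d : A →ₗ[R] A} (hφ : IsLieNDeriv n φ)
    (hd : IsDeriv d) : IsLieNDeriv n (φ - d) := by
  obtain ⟨k, rfl⟩ := Nat.exists_eq_add_of_le' hn
  rw [isLieNDeriv_iff] at hφ ⊢
  intro x
  have h : pLeib φ x (k + 1) = pLeib (φ - d) x (k + 1) + pLeib d x (k + 1) := by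
    rw [← pLeib_add, sub_add_cancel]
  rw [LinearMap.sub_apply, hφ, hd.map_pCom, h, add_sub_cancel_right]

lemma InCorner.innerDeriv_sandwich {i j s x : A} (hx : InCorner i i x) (h : j * i = 0)
    (h' : i * j = 0) : j * innerDeriv R s x * j = 0 := by
  have r := hx.rules h h'
  simp [innerDeriv_apply, mul_sub, mul_assoc, r]

theorem exists_decomposition {n : ℕ} (hn : 2 ≤ n) (h2 : TorsionFreeAt A 2)
    (hn1 : TorsionFreeAt A (n - 1)) {e f : A} (P : Peirce e f) (hf : f = 1 - e)
    (F : Faithful e f) (F' : Faithful f e) {φ : A →ₗ[R] A} (hφ : IsLieNDeriv n φ)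
    (hce : ∀ a, ∃ z, IsCent z ∧ f * φ (e * a * e) * f = f * z * f)
    (hcf : ∀ b, ∃ z, IsCent z ∧ e * φ (f * b * f) * e = e * z * e)
    (hc : ∀ m t, InCorner e f m → InCorner f e t →
      IsCent (e * φ (t * m) * e + f * φ (m * t) * f)) :
    ∃ d δ γ : A →ₗ[R] A, IsDeriv d ∧ IsSingularJordanDeriv e δ ∧
      (∀ x : A, IsCent (γ x)) ∧ VanishesOnNCommutators n γ ∧ φ = d + δ + γ := by
  set s := e * φ e * f - f * φ e * e with hs
  have hi : innerDeriv R s e = e * φ e * f + f * φ e * e := by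
    have r1 := (InCorner.mk' P.ee P.ff (φ e)).rules P.fe P.fe
    have r2 := (InCorner.mk' P.ff P.ee (φ e)).rules P.ef P.ef
    rw [innerDeriv_apply, hs, mul_sub, sub_mul, r1.1, r1.2.2.2.1, r2.2.1, r2.2.2.1]
    abel
  have hφ' := hφ.sub_isDeriv hn (isDeriv_innerDeriv s)
  suffices h : ∃ d δ γ : A →ₗ[R] A, IsDeriv d ∧ IsSingularJordanDeriv e δ ∧
      (∀ x : A, IsCent (γ x)) ∧ VanishesOnNCommutators n γ ∧ φ - innerDeriv R s = d + δ + γ by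
    obtain ⟨d, δ, γ, hd, hδ, hγ, hv, hsum⟩ := h
    refine ⟨d + innerDeriv R s, δ, γ, fun x y => ?_, hδ, hγ, hv, ?_⟩
    · simp only [LinearMap.add_apply, hd _ _, isDeriv_innerDeriv s _ _]; noncomm_ring
    · rw [eq_add_of_sub_eq hsum]; abel
  refine exists_decomposition_of_diag hn h2 hn1 P hf F F' hφ' ?_ ?_ ?_ ?_ ?_
  · rw [LinearMap.sub_apply, hi, mul_sub, sub_mul, mul_add, add_mul,
      (InCorner.mk' P.ee P.ff (φ e)).1, ((InCorner.mk' P.ff P.ee (φ e)).rules P.ef P.ef).2.2.1,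
      (InCorner.mk' P.ee P.ff (φ e)).2]
    simp
  · rw [LinearMap.sub_apply, hi, mul_sub, sub_mul, mul_add, add_mul,
      (InCorner.mk' P.ff P.ee (φ e)).1, ((InCorner.mk' P.ee P.ff (φ e)).rules P.fe P.fe).2.2.1,
      (InCorner.mk' P.ff P.ee (φ e)).2]
    simp
  · intro a
    rw [LinearMap.sub_apply, mul_sub, sub_mul,
      (InCorner.mk' P.ee P.ee a).innerDeriv_sandwich P.fe P.ef, sub_zero]
    exact hce a
  · intro b
    rw [LinearMap.sub_apply, mul_sub, sub_mul,
      (InCorner.mk' P.ff P.ff b).innerDeriv_sandwich P.ef P.fe, sub_zero]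
    exact hcf b
  · intro m t hm ht
    rw [LinearMap.sub_apply, LinearMap.sub_apply, mul_sub, sub_mul, mul_sub, sub_mul,
      (ht.mul hm).innerDeriv_sandwich P.ef P.fe, (hm.mul ht).innerDeriv_sandwich P.fe P.ef,
      sub_zero, sub_zero]
    exact hc m t hm ht

lemma VanishesOnNCommutators.map_mul_comm {n : ℕ} (hn : 2 ≤ n) {e f : A} (P : Peirce e f)
    {γ : A →ₗ[R] A} (hγ : VanishesOnNCommutators n γ) {m t : A} (hm : InCorner e f m) :
    γ (m * t) = γ (t * m) := by
  obtain ⟨k, rfl⟩ := Nat.exists_eq_add_of_le' hn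
  let s : ℕ → A := fun i => if i = 0 then m else if i = k + 1 then t else e
  have hs : ∀ j ≤ k, pCom s j = (bracketWith e)^[j] m := by
    intro j hj
    induction j with
    | zero => rfl
    | succ j ih =>
      have hse : s (j + 1) = e := by
        simp only [s]
        rw [if_neg (by omega), if_neg (by omega)]
      rw [Function.iterate_succ_apply', ← ih (by omega), pCom, hse]; rfl
  have h : γ (pCom s (k + 1)) = 0 := hγ s
  rw [pCom, hs k le_rfl, show s (k + 1) = t by simp [s], iterate_bracketWith_corner P k hm,
    smul_mul_assoc, mul_smul_comm, ← smul_sub, map_zsmul, map_sub] at h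
  rw [← sub_eq_zero]
  rcases neg_one_pow_eq_or ℤ k with hk | hk
  · simpa [hk] using h
  · rw [hk, neg_smul, one_smul, neg_eq_zero] at h
    exact h

lemma IsDeriv.sandwich_eq_zero {i j x : A} {d : A →ₗ[R] A} (hd : IsDeriv d)
    (hx : InCorner i i x) (h : j * i = 0) (h' : i * j = 0) : j * d x * j = 0 := by
  have r := hx.rules h h'
  have h1 : d x = d i * x + i * d x := by rw [← hd, hx.1]
  rw [h1, mul_add, add_mul, ← mul_assoc j i, h, mul_assoc j, mul_assoc (d i), r.2.2.2.1]
  simp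

end Peirce

theorem stmt_3 (R : Type*) [CommRing R] (A : Type*) [Ring A] [Algebra R A]
    (n : ℕ) (hn : 2 ≤ n)
    (h2 : TorsionFreeAt A 2) (hn1 : TorsionFreeAt A (n - 1))
    (e : A) (he : e * e = e) (he0 : e ≠ 0) (he1 : e ≠ 1) (hQ : PropQ e)
    (φ : A →ₗ[R] A) (hφ : IsLieNDeriv n φ) :
    (∃ d δ γ : A →ₗ[R] A,
        IsDeriv d ∧ IsSingularJordanDeriv e δ ∧
        (∀ x : A, IsCent (γ x)) ∧ VanishesOnNCommutators n γ ∧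
        φ = d + δ + γ) ↔
      ((∀ a : A, ∃ z : A, IsCent z ∧
          (1 - e) * φ (e * a * e) * (1 - e) = (1 - e) * z * (1 - e)) ∧
       (∀ b : A, ∃ z : A, IsCent z ∧
          e * φ ((1 - e) * b * (1 - e)) * e = e * z * e) ∧
       (∀ m t : A, IsCent
          (e * φ (((1 - e) * t * e) * (e * m * (1 - e))) * e +
           (1 - e) * φ ((e * m * (1 - e)) * ((1 - e) * t * e)) * (1 - e)))) := by
  have P := Peirce.of_idempotent he
  obtain ⟨F, F'⟩ := hQ.faithful P
  constructor
  · rintro ⟨d, δ, γ, hd, ⟨-, hδe, hδf, -, -⟩, hγ, hv, rfl⟩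
    have ke : ∀ a, InCorner e e a →
        (1 - e) * (d + δ + γ) a * (1 - e) = (1 - e) * γ a * (1 - e) := fun a ha => by
      have h0 : δ a = 0 := by rw [← ha.sandwich, hδe]
      rw [LinearMap.add_apply, LinearMap.add_apply, h0, add_zero, mul_add, add_mul,
        hd.sandwich_eq_zero ha P.fe P.ef, zero_add]
    have kf : ∀ b, InCorner (1 - e) (1 - e) b →
        e * (d + δ + γ) b * e = e * γ b * e := fun b hb => by
      have h0 : δ b = 0 := by rw [← hb.sandwich, hδf]
      rw [LinearMap.add_apply, LinearMap.add_apply, h0, add_zero, mul_add, add_mul,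
        hd.sandwich_eq_zero hb P.ef P.fe, zero_add]
    refine ⟨fun a => ⟨_, hγ _, ke _ (.mk' P.ee P.ee a)⟩,
      fun b => ⟨_, hγ _, kf _ (.mk' P.ff P.ff b)⟩, fun m t => ?_⟩
    have hm := InCorner.mk' P.ee P.ff m
    have ht := InCorner.mk' P.ff P.ee t
    rw [kf _ (ht.mul hm), ke _ (hm.mul ht), hv.map_mul_comm hn P hm]
    have hz := hγ ((1 - e) * t * e * (e * m * (1 - e)))
    have h := P.decomp (γ ((1 - e) * t * e * (e * m * (1 - e))))
    rw [hz.sandwich_eq_zero P, hz.sandwich_eq_zero P.symm, add_zero, add_zero] at h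
    rwa [h] at hz
  · rintro ⟨hce, hcf, hc⟩
    refine exists_decomposition hn h2 hn1 P rfl F F' hφ hce hcf fun m t hm ht => ?_
    have := hc m t
    rwa [hm.sandwich, ht.sandwich] at this
end
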